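/- (Key omniprediction bound) Let D be a distribution on finite X × {0,1}, S = {S_1,...,S_m} a partition, c : X → ℝ, and ℓ : {0,1} × ℝ → ℝ such that ℓ(y,·) is convex for each y and B-Lipschitz on a closed interval I which contains an ε-approximate minimizer of ℓ(y,·) for each y. Define ĉ(x) = clip(E_{D_i}[c(x')], I) for x ∈ S_i. If for each b ∈ {0,1}, Σ_i D(S_i)·Pr_{D_i}[y=b]·|E_{D_i | y=b}[c(x)] − E_{D_i}[c(x)]| ≤ α, then E_D[ℓ(y, ĉ(x))] ≤ E_D[ℓ(y, c(x))] + 2αB + ε. -/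

import Mathlib

open Finset

variable {X : Type*} [Fintype X] {m : ℕ}

/-- Probability mass `D(S_i)` of state `i` of the partition given by `σ`. -/
noncomputable def smass (D : X → Bool → ℝ) (σ : X → Fin m) (i : Fin m) : ℝ :=
  ∑ x, ∑ b, if σ x = i then D x b else 0

/-- Joint mass `D(S_i ∧ y = b)`. -/
noncomputable def massb (D : X → Bool → ℝ) (σ : X → Fin m) (i : Fin m) (b : Bool) : ℝ :=
  ∑ x, if σ x = i then D x b else 0

/-- Conditional expectation `E_{D_i}[c(x)]` on state `i`. -/
noncomputable def scexp (D : X → Bool → ℝ) (σ : X → Fin m) (i : Fin m) (c : X → ℝ) : ℝ :=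
  (∑ x, ∑ b, if σ x = i then D x b * c x else 0) / smass D σ i

/-- Conditional expectation `E_{D_i | y = b}[c(x)]` on state `i` given label `b`. -/
noncomputable def scexpb (D : X → Bool → ℝ) (σ : X → Fin m) (i : Fin m) (b : Bool)
    (c : X → ℝ) : ℝ :=
  (∑ x, if σ x = i then D x b * c x else 0) / massb D σ i b

/-- Clipping to the interval `[lo,hi]`. -/
noncomputable def clip (lo hi t : ℝ) : ℝ := max lo (min t hi)

theorem clip_mem_Icc {lo hi : ℝ} (h : lo ≤ hi) (t : ℝ) : clip lo hi t ∈ Set.Icc lo hi :=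
  ⟨le_max_left _ _, max_le h (min_le_right _ _)⟩

theorem abs_clip_sub_clip_le (lo hi s t : ℝ) : |clip lo hi s - clip lo hi t| ≤ |s - t| := by
  unfold clip
  calc |max lo (min s hi) - max lo (min t hi)|
      ≤ max |lo - lo| |min s hi - min t hi| := abs_max_sub_max_le_max _ _ _ _
    _ = |min s hi - min t hi| := by simp
    _ ≤ max |s - t| |hi - hi| := abs_min_sub_min_le_max _ _ _ _
    _ = |s - t| := by simp

/-- For a convex function whose near-minimizer `t₀` lies in `[lo, hi]`, clipping to `[lo, hi]`
increases the value by at most `ε`. -/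
theorem ConvexOn.apply_clip_le {f : ℝ → ℝ} (hf : ConvexOn ℝ Set.univ f) {lo hi ε t₀ : ℝ}
    (hε : 0 ≤ ε) (ht₀ : t₀ ∈ Set.Icc lo hi) (hmin : ∀ s, f t₀ ≤ f s + ε) (s : ℝ) :
    f (clip lo hi s) ≤ f s + ε := by
  have hseg : clip lo hi s ∈ segment ℝ t₀ s := by
    rw [segment_eq_uIcc, Set.mem_uIcc]
    obtain ⟨h₁, h₂⟩ := ht₀
    unfold clip
    grind
  exact (hf.le_on_segment (Set.mem_univ _) (Set.mem_univ _) hseg).trans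
    (max_le (hmin s) (by linarith))

/-- A function that is Lipschitz on a nonempty `[lo, hi]` attains its infimum there. -/
theorem exists_mem_Icc_eq_sInf_image {f : ℝ → ℝ} {lo hi B : ℝ} (h : lo ≤ hi) (hB : 0 ≤ B)
    (hlip : ∀ t ∈ Set.Icc lo hi, ∀ t' ∈ Set.Icc lo hi, |f t - f t'| ≤ B * |t - t'|) :
    ∃ t₀ ∈ Set.Icc lo hi, sInf (f '' Set.Icc lo hi) = f t₀ := by
  have hL : LipschitzOnWith ⟨B, hB⟩ f (Set.Icc lo hi) :=
    LipschitzOnWith.of_dist_le_mul fun t ht t' ht' => hlip t ht t' ht'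
  exact isCompact_Icc.exists_sInf_image_eq (Set.nonempty_Icc.2 h) hL.continuousOn

theorem massb_nonneg {D : X → Bool → ℝ} (hD : ∀ x b, 0 ≤ D x b) (σ : X → Fin m) (i : Fin m)
    (b : Bool) : 0 ≤ massb D σ i b :=
  sum_nonneg fun x _ => by split_ifs <;> simp [hD]

theorem smass_eq_massb_add (D : X → Bool → ℝ) (σ : X → Fin m) (i : Fin m) :
    smass D σ i = massb D σ i true + massb D σ i false := by
  simp only [smass, massb, Fintype.sum_bool, sum_add_distrib]

theorem smass_mul_massb_div {D : X → Bool → ℝ} (hD : ∀ x b, 0 ≤ D x b) (σ : X → Fin m)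
    (i : Fin m) (b : Bool) :
    smass D σ i * (massb D σ i b / smass D σ i) = massb D σ i b := by
  refine mul_div_cancel_of_imp' fun h => ?_
  have h₁ := massb_nonneg hD σ i true
  have h₂ := massb_nonneg hD σ i false
  rw [smass_eq_massb_add] at h
  cases b <;> linarith

theorem sum_ite_state {σ : X → Fin m} (f : X → ℝ) :
    ∑ i, ∑ x, (if σ x = i then f x else 0) = ∑ x, f x := by
  rw [sum_comm]
  simp

/-- Jensen's inequality on the part of a state with a given label. -/
theorem massb_mul_apply_scexpb_le {D : X → Bool → ℝ} (hD : ∀ x b, 0 ≤ D x b) (σ : X → Fin m)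
    (i : Fin m) (b : Bool) (c : X → ℝ) {f : ℝ → ℝ} (hf : ConvexOn ℝ Set.univ f) :
    massb D σ i b * f (scexpb D σ i b c) ≤ ∑ x, if σ x = i then D x b * f (c x) else 0 := by
  rcases (massb_nonneg hD σ i b).eq_or_lt with h | h
  · have hz := (sum_eq_zero_iff_of_nonneg fun x _ => by split_ifs <;> simp [hD]).1 h.symm
    rw [← h, zero_mul]
    refine (sum_eq_zero fun x hx => ?_).ge
    have hx₀ := hz x hx
    split_ifs at hx₀ ⊢
    · rw [hx₀, zero_mul]
    · rfl
  · have hJ := hf.map_centerMass_le (t := univ.filter fun x => σ x = i) (w := fun x => D x b)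
      (p := c) (fun x _ => hD x b) (by rwa [sum_filter]) fun _ _ => Set.mem_univ _
    simp only [centerMass, smul_eq_mul, sum_filter, Function.comp_apply] at hJ
    change f ((massb D σ i b)⁻¹ * _) ≤ (massb D σ i b)⁻¹ * _ at hJ
    rw [inv_mul_eq_div, inv_mul_eq_div, le_div_iff₀' h] at hJ
    exact hJ

/-- Key omniprediction bound: if `ℓ(y,·)` is convex, `B`-Lipschitz on `I = [lo,hi]`, `I`
contains an `ε`-approximate minimizer of `ℓ(y,·)`, and the partition satisfies the
multicalibration consequence `Σ_i D(S_i)·Pr_{D_i}[y=b]·|E_{D_i|y=b}[c] − E_{D_i}[c]| ≤ α`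
for each `b`, then the clipped state-averaged hypothesis `ĉ` satisfies
`E_D[ℓ(y, ĉ(x))] ≤ E_D[ℓ(y, c(x))] + 2αB + ε`. -/
theorem key_omniprediction_bound {X : Type*} [Fintype X] {m : ℕ}
    (D : X → Bool → ℝ) (hD : ∀ x b, 0 ≤ D x b) (hD1 : ∑ x, ∑ b, D x b = 1)
    (σ : X → Fin m) (c : X → ℝ) (ℓ : Bool → ℝ → ℝ) (lo hi B ε α : ℝ)
    (hlohi : lo ≤ hi) (hB : 0 ≤ B) (hε : 0 ≤ ε)
    (hconv : ∀ b, ConvexOn ℝ Set.univ (ℓ b))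
    (hlip : ∀ b, ∀ t ∈ Set.Icc lo hi, ∀ t' ∈ Set.Icc lo hi,
      |ℓ b t - ℓ b t'| ≤ B * |t - t'|)
    (hopt : ∀ b, ∀ s : ℝ, sInf (ℓ b '' Set.Icc lo hi) ≤ ℓ b s + ε)
    (hmc : ∀ b : Bool,
      ∑ i, smass D σ i * (massb D σ i b / smass D σ i)
          * |scexpb D σ i b c - scexp D σ i c| ≤ α) :
    ∑ x, ∑ b, D x b * ℓ b (clip lo hi (scexp D σ (σ x) c))
      ≤ (∑ x, ∑ b, D x b * ℓ b (c x)) + 2 * α * B + ε := by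
  have hclip : ∀ b s, ℓ b (clip lo hi s) ≤ ℓ b s + ε := fun b => by
    obtain ⟨t₀, ht₀, he⟩ := exists_mem_Icc_eq_sInf_image hlohi hB (hlip b)
    exact (hconv b).apply_clip_le hε ht₀ fun s => he ▸ hopt b s
  have hstate : ∀ b i, massb D σ i b * ℓ b (clip lo hi (scexp D σ i c))
      ≤ (∑ x, if σ x = i then D x b * ℓ b (c x) else 0)
        + B * (massb D σ i b * |scexpb D σ i b c - scexp D σ i c|) + ε * massb D σ i b := by
    intro b i
    have h₁ := (abs_le.1 (hlip b _ (clip_mem_Icc hlohi (scexpb D σ i b c)) _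
      (clip_mem_Icc hlohi (scexp D σ i c)))).1
    have h₂ := mul_le_mul_of_nonneg_left
      (abs_clip_sub_clip_le lo hi (scexpb D σ i b c) (scexp D σ i c)) hB
    have h₃ := hclip b (scexpb D σ i b c)
    have h₄ : ℓ b (clip lo hi (scexp D σ i c)) ≤ ℓ b (scexpb D σ i b c)
        + B * |scexpb D σ i b c - scexp D σ i c| + ε := by linarith
    have h₅ := mul_le_mul_of_nonneg_left h₄ (massb_nonneg hD σ i b)
    have h₆ := massb_mul_apply_scexpb_le hD σ i b c (hconv b)
    linarith
  have hlabel : ∀ b, ∑ x, D x b * ℓ b (clip lo hi (scexp D σ (σ x) c))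
      ≤ (∑ x, D x b * ℓ b (c x)) + B * α + ε * ∑ x, D x b := by
    intro b
    have hα := hmc b
    simp only [smass_mul_massb_div hD] at hα
    have hsum := sum_le_sum fun i (_ : i ∈ univ) => hstate b i
    rw [sum_add_distrib, sum_add_distrib, sum_ite_state, ← mul_sum, ← mul_sum] at hsum
    have hmass : ∑ i, massb D σ i b = ∑ x, D x b := sum_ite_state _
    have hleft : ∑ i, massb D σ i b * ℓ b (clip lo hi (scexp D σ i c))
        = ∑ x, D x b * ℓ b (clip lo hi (scexp D σ (σ x) c)) := by
      simp only [massb, sum_mul, ite_mul, zero_mul]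
      rw [sum_comm]
      simp
    rw [hleft, hmass] at hsum
    linarith [mul_le_mul_of_nonneg_left hα hB]
  have ht := hlabel true
  have hf := hlabel false
  simp only [Fintype.sum_bool, sum_add_distrib] at hD1 ⊢
  linear_combination ht + hf + ε * hD1
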